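/- arXiv:2311.15523 — 2 statements merged into one kernel-verified Lean document; each statement's English description precedes it below -/
import Mathlib

section
/- Let $r \geq 1$ and let $Q$ be a subgroup of $\mathbb{Z}^r$ of finite index $n$. Then the submonoid $C := Q \cap \mathbb{Z}_{\geq 0}^r$ of $(\mathbb{Z}^r,+)$ is generated, as a monoid, by the finite set of its elements all of whose coordinates are at most $n$ (i.e. by $C \cap [0,n]^r$). In particular, $C$ is a finitely generated monoid. -/
/-- The vector with a single nonzero coordinate, equal to the index of `Q`, lies in `Q`. -/
lemma AddSubgroup.single_index_mem {r : ℕ} (Q : AddSubgroup (Fin r → ℤ)) (i : Fin r) :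
    Pi.single i (Q.index : ℤ) ∈ Q := by
  have h := Q.nsmul_index_mem (Pi.single i 1)
  rwa [← Pi.single_smul, nsmul_one] at h

/-- Let `Q` be a subgroup of `ℤ^r` (with `r ≥ 1`) of finite index `n`.
Then the submonoid `C := Q ∩ ℤ_{≥0}^r` of `(ℤ^r, +)` is generated, as a monoid, by the
finite set of its elements all of whose coordinates are at most `n`, i.e. by `C ∩ [0,n]^r`.
In particular `C` is a finitely generated monoid. -/
theorem stmt_0 (r n : ℕ) (hr : 1 ≤ r) (Q : AddSubgroup (Fin r → ℤ))
    (hn : Q.index = n) (hn0 : n ≠ 0) :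
    {x : Fin r → ℤ | x ∈ Q ∧ ∀ i, 0 ≤ x i ∧ x i ≤ (n : ℤ)}.Finite ∧
    ∀ x : Fin r → ℤ,
      (x ∈ Q ∧ ∀ i, 0 ≤ x i) ↔
        x ∈ AddSubmonoid.closure {y : Fin r → ℤ | y ∈ Q ∧ ∀ i, 0 ≤ y i ∧ y i ≤ (n : ℤ)} := by
  subst hn
  refine ⟨(Set.finite_Icc (0 : Fin r → ℤ) (fun _ => (Q.index : ℤ))).subset
    fun x hx => ⟨fun i => (hx.2 i).1, fun i => (hx.2 i).2⟩, fun x => ⟨?_, fun hx => ?_⟩⟩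
  · rintro ⟨hxQ, hx⟩
    induction hN : (∑ i, x i).toNat using Nat.strong_induction_on generalizing x with
    | _ N ih =>
      by_cases hle : ∀ i, x i ≤ Q.index
      · exact AddSubmonoid.subset_closure ⟨hxQ, fun i => ⟨hx i, hle i⟩⟩
      push Not at hle
      obtain ⟨i, hi⟩ := hle
      have hsingle : ∀ j, 0 ≤ (Pi.single i (Q.index : ℤ) : Fin r → ℤ) j ∧
          (Pi.single i (Q.index : ℤ) : Fin r → ℤ) j ≤ Q.index := by
        intro j
        rcases eq_or_ne j i with rfl | hj
        · simp
        · simp [hj]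
      rw [← sub_add_cancel x (Pi.single i (Q.index : ℤ))]
      refine add_mem (ih _ ?_ _ (sub_mem hxQ (Q.single_index_mem i)) (fun j => ?_) rfl)
        (AddSubmonoid.subset_closure ⟨Q.single_index_mem i, hsingle⟩)
      · have hsum : x i ≤ ∑ j, x j :=
          Finset.single_le_sum (fun j _ => hx j) (Finset.mem_univ i)
        simp only [Pi.sub_apply, Finset.sum_sub_distrib, Finset.sum_pi_single', Finset.mem_univ,
          if_true]
        omega
      · rcases eq_or_ne j i with rfl | hj
        · simpa using hi.le
        · simpa [hj] using hx j
  · induction hx using AddSubmonoid.closure_induction with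
    | mem y hy => exact ⟨hy.1, fun i => (hy.2 i).1⟩
    | zero => exact ⟨zero_mem Q, fun _ => le_rfl⟩
    | add y z _ _ hy hz => exact ⟨add_mem hy.1 hz.1, fun i => add_nonneg (hy.2 i) (hz.2 i)⟩
end

section
/- Let $r \geq 1$, let $Q$ be a subgroup of $\mathbb{Z}^r$ of finite index, and set $C := Q \cap \mathbb{Z}_{\geq 0}^r$. If $\Lambda \subseteq C$ is closed under addition of elements of $C$ (i.e. $\Lambda + C \subseteq \Lambda$), then there exist finitely many elements $x_1,\dots,x_k \in \Lambda$ (possibly $k = 0$, when $\Lambda$ is empty) such that $\Lambda = \bigcup_{i=1}^{k} (x_i + C)$. -/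
/-- Dickson's lemma for the non-negative orthant of `ℤ^r`. -/
theorem isPWO_setOf_forall_nonneg (r : ℕ) : {x : Fin r → ℤ | ∀ i, 0 ≤ x i}.IsPWO := by
  have h : (Set.Ici (0 : ℤ)).IsPWO := Set.isPWO_iff_isWF.2 bddBelow_Ici.isWF
  exact (Set.IsPWO.pi fun _ : Fin r => h).mono fun x hx i _ => hx i

/-- Let `Q` be a finite-index subgroup of `ℤ^r` (with `r ≥ 1`) and let
`C := Q ∩ ℤ_{≥0}^r`. If `Λ ⊆ C` satisfies `Λ + C ⊆ Λ`, then there are finitely many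
elements `x₁, …, x_k ∈ Λ` (possibly `k = 0`, when `Λ` is empty) with
`Λ = ⋃ i, (xᵢ + C)`. -/
theorem stmt_1 (r : ℕ) (hr : 1 ≤ r) (Q : AddSubgroup (Fin r → ℤ))
    (hQ : Q.index ≠ 0)
    (C : Set (Fin r → ℤ)) (hC : C = {x : Fin r → ℤ | x ∈ Q ∧ ∀ i, 0 ≤ x i})
    (Λ : Set (Fin r → ℤ)) (hΛC : Λ ⊆ C)
    (hadd : ∀ x ∈ Λ, ∀ c ∈ C, x + c ∈ Λ) :
    ∃ S : Finset (Fin r → ℤ), (S : Set (Fin r → ℤ)) ⊆ Λ ∧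
      Λ = ⋃ x ∈ S, (fun c => x + c) '' C := by
  have hpwo : Λ.IsPWO := (isPWO_setOf_forall_nonneg r).mono fun x hx i => by
    have := hΛC hx
    rw [hC] at this
    exact this.2 i
  have hfin : {x | Minimal (· ∈ Λ) x}.Finite :=
    (setOfPred_minimal_antichain (· ∈ Λ)).finite_of_partiallyWellOrderedOn
      (hpwo.mono fun x hx => hx.prop)
  refine ⟨hfin.toFinset, fun x hx => (hfin.mem_toFinset.1 hx).prop, ?_⟩
  ext y
  simp only [Set.Finite.mem_toFinset, Set.mem_ofPred_eq, Set.mem_iUnion, Set.mem_image,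
    exists_prop]
  constructor
  · intro hy
    obtain ⟨x, hxy, hx⟩ := hpwo.exists_le_minimal hy
    refine ⟨x, hx, y - x, ?_, add_sub_cancel x y⟩
    have hxC := hΛC hx.prop
    have hyC := hΛC hy
    rw [hC] at hxC hyC ⊢
    exact ⟨Q.sub_mem hyC.1 hxC.1, fun i => sub_nonneg.2 (hxy i)⟩
  · rintro ⟨x, hx, c, hc, rfl⟩
    exact hadd x hx.prop c hc
end
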